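/- arXiv:1411.0476 — 2 statements merged into one kernel-verified Lean document; each statement's English description precedes it below -/
import Mathlib

section
/- Let h > 0 and let f : ℝ⁴ → ℝ be a smooth, everywhere positive function of (n, x, y, t) satisfying, at every point, (D_x⁴ − 4D_xD_t + 3D_y²) f·f = 0, (D_y − D_x² + (2/h)D_x) f_n·f_{n−h} = 0, and (3D_yD_x − 4D_t + D_x³ − (6/h)D_y) f_n·f_{n−h} = 0. Define w := ln f, v := ∂_x w, u := ∂_x v, p := ∂_x u, q := ∂_x p, r := ∂_x q. Then at every point (with the n-argument shifted as shown and all other arguments equal): (i) 4∂_t u − r − 12up − 3∂_y²v = 0; (ii) p(n+h) + p(n) = (2/h)(u(n+h) − u(n)) + (∂_y v(n+h) − ∂_y v(n)) − 2(v(n+h) − v(n))(u(n+h) − u(n)); (iii) q(n+h) + q(n) = (2/h)(p(n+h) − p(n)) + (∂_y u(n+h) − ∂_y u(n)) − 2(v(n+h) − v(n))(p(n+h) − p(n)) − 2(u(n+h) − u(n))²; (iv) r(n+h) + r(n) = (2/h)(q(n+h) − q(n)) + (∂_y p(n+h) − ∂_y p(n)) − 2(v(n+h) − v(n))(q(n+h)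 − q(n)) − 6(u(n+h) − u(n))(p(n+h) − p(n)); (v) 3(∂_y u(n+h) + ∂_y u(n)) + 6(u(n+h) + u(n))(u(n+h) − u(n)) + 6(u(n+h) − u(n))(v(n+h) − v(n))² + 3(∂_y v(n+h) − ∂_y v(n))(v(n+h) − v(n)) − 4(∂_t v(n+h) − ∂_t v(n)) + (q(n+h) − q(n)) + 3(v(n+h) − v(n))(p(n+h) + p(n)) − (6/h)(u(n+h) − u(n))(v(n+h) − v(n)) = (6/h)(∂_y v(n+h) − ∂_y v(n)). -/
/-- Hirota bilinear operator `D_x^a D_y^b D_t^c e^{δ D_n}` applied to a pair of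
functions of `(n, x, y, t)`, evaluated at `(n, x, y, t)`. -/
noncomputable def hirota4 (a b c : ℕ) (δ : ℝ) (A B : ℝ → ℝ → ℝ → ℝ → ℝ) (n x y t : ℝ) : ℝ :=
  iteratedDeriv a (fun r =>
    iteratedDeriv b (fun s =>
      iteratedDeriv c (fun w =>
        A (n + δ) (x + r) (y + s) (t + w) * B (n - δ) (x - r) (y - s) (t - w)) 0) 0) 0

open scoped ContDiff

/-- Joint smoothness of a function of `(n, x, y, t)`. -/
def Smooth4 (g : ℝ → ℝ → ℝ → ℝ → ℝ) : Prop :=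
  ContDiff ℝ ∞ (fun z : ℝ × ℝ × ℝ × ℝ => g z.1 z.2.1 z.2.2.1 z.2.2.2)

/-- Partial derivative in `x`. -/
noncomputable def partialX (g : ℝ → ℝ → ℝ → ℝ → ℝ) (n x y t : ℝ) : ℝ :=
  deriv (fun x' => g n x' y t) x

/-- Partial derivative in `y`. -/
noncomputable def partialY (g : ℝ → ℝ → ℝ → ℝ → ℝ) (n x y t : ℝ) : ℝ :=
  deriv (fun y' => g n x y' t) y

/-- Partial derivative in `t`. -/
noncomputable def partialT (g : ℝ → ℝ → ℝ → ℝ → ℝ) (n x y t : ℝ) : ℝ :=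
  deriv (fun t' => g n x y t') t

theorem fderiv_apply_comm_of_contDiff {E : Type*} [NormedAddCommGroup E] [NormedSpace ℝ E]
    {g : E → ℝ} (hg : ContDiff ℝ ∞ g) (e e' z : E) :
    fderiv ℝ (fun z => fderiv ℝ g z e) z e' = fderiv ℝ (fun z => fderiv ℝ g z e') z e := by
  have hd : DifferentiableAt ℝ (fderiv ℝ g) z :=
    ((hg.fderiv_right (m := ∞) (by simp)).differentiable (by simp)) z
  have hsymm : IsSymmSndFDerivAt ℝ g z :=
    hg.contDiffAt.isSymmSndFDerivAt (by simpa using WithTop.coe_le_coe.2 (le_top (a := (2 : ℕ∞))))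
  rw [fderiv_clm_apply hd (differentiableAt_const _), fderiv_clm_apply hd (differentiableAt_const _)]
  simpa using hsymm e' e

namespace Smooth4

variable {g : ℝ → ℝ → ℝ → ℝ → ℝ}

theorem hasDerivAt_fderiv_x (hg : Smooth4 g) (n x y t : ℝ) :
    HasDerivAt (fun x' => g n x' y t)
      (fderiv ℝ (fun z : ℝ × ℝ × ℝ × ℝ => g z.1 z.2.1 z.2.2.1 z.2.2.2) (n, x, y, t)
        (0, 1, 0, 0)) x :=
  (ContDiff.differentiable hg (by simp) (n, x, y, t)).hasFDerivAt.comp_hasDerivAt x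
    (f := fun x => (n, x, y, t))
    ((hasDerivAt_const x n).prodMk
      ((hasDerivAt_id x).prodMk ((hasDerivAt_const x y).prodMk (hasDerivAt_const x t))))

theorem hasDerivAt_fderiv_y (hg : Smooth4 g) (n x y t : ℝ) :
    HasDerivAt (fun y' => g n x y' t)
      (fderiv ℝ (fun z : ℝ × ℝ × ℝ × ℝ => g z.1 z.2.1 z.2.2.1 z.2.2.2) (n, x, y, t)
        (0, 0, 1, 0)) y :=
  (ContDiff.differentiable hg (by simp) (n, x, y, t)).hasFDerivAt.comp_hasDerivAt y
    (f := fun y => (n, x, y, t))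
    ((hasDerivAt_const y n).prodMk
      ((hasDerivAt_const y x).prodMk ((hasDerivAt_id y).prodMk (hasDerivAt_const y t))))

theorem hasDerivAt_fderiv_t (hg : Smooth4 g) (n x y t : ℝ) :
    HasDerivAt (fun t' => g n x y t')
      (fderiv ℝ (fun z : ℝ × ℝ × ℝ × ℝ => g z.1 z.2.1 z.2.2.1 z.2.2.2) (n, x, y, t)
        (0, 0, 0, 1)) t :=
  (ContDiff.differentiable hg (by simp) (n, x, y, t)).hasFDerivAt.comp_hasDerivAt t
    (f := fun t => (n, x, y, t))
    ((hasDerivAt_const t n).prodMk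
      ((hasDerivAt_const t x).prodMk ((hasDerivAt_const t y).prodMk (hasDerivAt_id t))))

theorem hasDerivAt_x (hg : Smooth4 g) (n x y t : ℝ) :
    HasDerivAt (fun x' => g n x' y t) (partialX g n x y t) x :=
  (hg.hasDerivAt_fderiv_x n x y t).differentiableAt.hasDerivAt

theorem hasDerivAt_y (hg : Smooth4 g) (n x y t : ℝ) :
    HasDerivAt (fun y' => g n x y' t) (partialY g n x y t) y :=
  (hg.hasDerivAt_fderiv_y n x y t).differentiableAt.hasDerivAt

theorem hasDerivAt_t (hg : Smooth4 g) (n x y t : ℝ) :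
    HasDerivAt (fun t' => g n x y t') (partialT g n x y t) t :=
  (hg.hasDerivAt_fderiv_t n x y t).differentiableAt.hasDerivAt

theorem uncurry_partialX (hg : Smooth4 g) :
    (fun z : ℝ × ℝ × ℝ × ℝ => partialX g z.1 z.2.1 z.2.2.1 z.2.2.2) = fun z =>
      fderiv ℝ (fun z : ℝ × ℝ × ℝ × ℝ => g z.1 z.2.1 z.2.2.1 z.2.2.2) z (0, 1, 0, 0) :=
  funext fun z => (hg.hasDerivAt_fderiv_x z.1 z.2.1 z.2.2.1 z.2.2.2).deriv

theorem uncurry_partialY (hg : Smooth4 g) :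
    (fun z : ℝ × ℝ × ℝ × ℝ => partialY g z.1 z.2.1 z.2.2.1 z.2.2.2) = fun z =>
      fderiv ℝ (fun z : ℝ × ℝ × ℝ × ℝ => g z.1 z.2.1 z.2.2.1 z.2.2.2) z (0, 0, 1, 0) :=
  funext fun z => (hg.hasDerivAt_fderiv_y z.1 z.2.1 z.2.2.1 z.2.2.2).deriv

theorem uncurry_partialT (hg : Smooth4 g) :
    (fun z : ℝ × ℝ × ℝ × ℝ => partialT g z.1 z.2.1 z.2.2.1 z.2.2.2) = fun z =>
      fderiv ℝ (fun z : ℝ × ℝ × ℝ × ℝ => g z.1 z.2.1 z.2.2.1 z.2.2.2) z (0, 0, 0, 1) :=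
  funext fun z => (hg.hasDerivAt_fderiv_t z.1 z.2.1 z.2.2.1 z.2.2.2).deriv

theorem partialX (hg : Smooth4 g) : Smooth4 (partialX g) := by
  unfold Smooth4
  rw [hg.uncurry_partialX]
  exact (ContDiff.fderiv_right hg (by simp)).clm_apply contDiff_const

theorem partialY (hg : Smooth4 g) : Smooth4 (partialY g) := by
  unfold Smooth4
  rw [hg.uncurry_partialY]
  exact (ContDiff.fderiv_right hg (by simp)).clm_apply contDiff_const

theorem partialT (hg : Smooth4 g) : Smooth4 (partialT g) := by
  unfold Smooth4
  rw [hg.uncurry_partialT]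
  exact (ContDiff.fderiv_right hg (by simp)).clm_apply contDiff_const

theorem partialX_partialY (hg : Smooth4 g) :
    _root_.partialX (_root_.partialY g) = _root_.partialY (_root_.partialX g) := by
  funext n x y t
  have hX := congrFun hg.partialY.uncurry_partialX (n, x, y, t)
  have hY := congrFun hg.partialX.uncurry_partialY (n, x, y, t)
  rw [hg.uncurry_partialY] at hX
  rw [hg.uncurry_partialX] at hY
  exact hX.trans ((fderiv_apply_comm_of_contDiff hg _ _ _).trans hY.symm)

theorem partialX_partialT (hg : Smooth4 g) :
    _root_.partialX (_root_.partialT g) = _root_.partialT (_root_.partialX g) := by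
  funext n x y t
  have hX := congrFun hg.partialT.uncurry_partialX (n, x, y, t)
  have hT := congrFun hg.partialX.uncurry_partialT (n, x, y, t)
  rw [hg.uncurry_partialT] at hX
  rw [hg.uncurry_partialX] at hT
  exact hX.trans ((fderiv_apply_comm_of_contDiff hg _ _ _).trans hT.symm)

end Smooth4

section ExpDerivatives

variable {G₀ G₁ G₂ G₃ G₄ : ℝ → ℝ}

theorem iteratedDeriv_one_exp_comp (h₀ : ∀ r, HasDerivAt G₀ (G₁ r) r) :
    iteratedDeriv 1 (fun r => Real.exp (G₀ r)) = fun r => Real.exp (G₀ r) * G₁ r := by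
  rw [iteratedDeriv_one]
  exact funext fun r => (h₀ r).exp.deriv

theorem iteratedDeriv_two_exp_comp (h₀ : ∀ r, HasDerivAt G₀ (G₁ r) r)
    (h₁ : ∀ r, HasDerivAt G₁ (G₂ r) r) :
    iteratedDeriv 2 (fun r => Real.exp (G₀ r)) =
      fun r => Real.exp (G₀ r) * (G₂ r + G₁ r ^ 2) := by
  rw [iteratedDeriv_succ, iteratedDeriv_one_exp_comp h₀]
  exact funext fun r => (((h₀ r).exp.mul (h₁ r)).congr_deriv (by ring)).deriv

theorem iteratedDeriv_three_exp_comp (h₀ : ∀ r, HasDerivAt G₀ (G₁ r) r)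
    (h₁ : ∀ r, HasDerivAt G₁ (G₂ r) r) (h₂ : ∀ r, HasDerivAt G₂ (G₃ r) r) :
    iteratedDeriv 3 (fun r => Real.exp (G₀ r)) =
      fun r => Real.exp (G₀ r) * (G₃ r + 3 * G₁ r * G₂ r + G₁ r ^ 3) := by
  rw [iteratedDeriv_succ, iteratedDeriv_two_exp_comp h₀ h₁]
  exact funext fun r =>
    (((h₀ r).exp.mul ((h₂ r).add ((h₁ r).pow 2))).congr_deriv (by simp; ring)).deriv

theorem iteratedDeriv_four_exp_comp (h₀ : ∀ r, HasDerivAt G₀ (G₁ r) r)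
    (h₁ : ∀ r, HasDerivAt G₁ (G₂ r) r) (h₂ : ∀ r, HasDerivAt G₂ (G₃ r) r)
    (h₃ : ∀ r, HasDerivAt G₃ (G₄ r) r) :
    iteratedDeriv 4 (fun r => Real.exp (G₀ r)) = fun r => Real.exp (G₀ r) *
      (G₄ r + 4 * G₁ r * G₃ r + 3 * G₂ r ^ 2 + 6 * G₁ r ^ 2 * G₂ r + G₁ r ^ 4) := by
  rw [iteratedDeriv_succ, iteratedDeriv_three_exp_comp h₀ h₁ h₂]
  exact funext fun r => (((h₀ r).exp.mul (((h₃ r).add (((h₁ r).const_mul 3).mul (h₂ r))).add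
    ((h₁ r).pow 3))).congr_deriv (by simp; ring)).deriv

end ExpDerivatives

theorem HasDerivAt.reflected_add {a a' b b' : ℝ → ℝ} (ha : ∀ r, HasDerivAt a (a' r) r)
    (hb : ∀ r, HasDerivAt b (b' r) r) (x r : ℝ) :
    HasDerivAt (fun r => a (x + r) + b (x - r)) (a' (x + r) - b' (x - r)) r := by
  have h₁ := (ha (x + r)).comp_const_add x r
  have h₂ := (hb (x - r)).comp_const_sub x r
  exact (h₁.add h₂).congr_deriv (by ring)

theorem HasDerivAt.reflected_sub {a a' b b' : ℝ → ℝ} (ha : ∀ r, HasDerivAt a (a' r) r)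
    (hb : ∀ r, HasDerivAt b (b' r) r) (x r : ℝ) :
    HasDerivAt (fun r => a (x + r) - b (x - r)) (a' (x + r) + b' (x - r)) r := by
  have h₁ := (ha (x + r)).comp_const_add x r
  have h₂ := (hb (x - r)).comp_const_sub x r
  exact (h₁.sub h₂).congr_deriv (by ring)

section Hirota

variable {a b : ℝ → ℝ → ℝ → ℝ → ℝ}

theorem hirota4_x_exp (ha : Smooth4 a) (hb : Smooth4 b) (n x y t : ℝ) :
    hirota4 1 0 0 0 (fun n x y t => Real.exp (a n x y t))
        (fun n x y t => Real.exp (b n x y t)) n x y t =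
      Real.exp (a n x y t + b n x y t) * (partialX a n x y t - partialX b n x y t) := by
  simp only [hirota4, iteratedDeriv_zero, add_zero, sub_zero, ← Real.exp_add]
  rw [iteratedDeriv_one_exp_comp
    (HasDerivAt.reflected_add (ha.hasDerivAt_x n · y t) (hb.hasDerivAt_x n · y t) x)]
  simp

theorem hirota4_y_exp (ha : Smooth4 a) (hb : Smooth4 b) (n x y t : ℝ) :
    hirota4 0 1 0 0 (fun n x y t => Real.exp (a n x y t))
        (fun n x y t => Real.exp (b n x y t)) n x y t =
      Real.exp (a n x y t + b n x y t) * (partialY a n x y t - partialY b n x y t) := by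
  simp only [hirota4, iteratedDeriv_zero, add_zero, sub_zero, ← Real.exp_add]
  rw [iteratedDeriv_one_exp_comp
    (HasDerivAt.reflected_add (ha.hasDerivAt_y n x · t) (hb.hasDerivAt_y n x · t) y)]
  simp

theorem hirota4_t_exp (ha : Smooth4 a) (hb : Smooth4 b) (n x y t : ℝ) :
    hirota4 0 0 1 0 (fun n x y t => Real.exp (a n x y t))
        (fun n x y t => Real.exp (b n x y t)) n x y t =
      Real.exp (a n x y t + b n x y t) * (partialT a n x y t - partialT b n x y t) := by
  simp only [hirota4, iteratedDeriv_zero, add_zero, sub_zero, ← Real.exp_add]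
  rw [iteratedDeriv_one_exp_comp
    (HasDerivAt.reflected_add (ha.hasDerivAt_t n x y) (hb.hasDerivAt_t n x y) t)]
  simp

theorem hirota4_xx_exp (ha : Smooth4 a) (hb : Smooth4 b) (n x y t : ℝ) :
    hirota4 2 0 0 0 (fun n x y t => Real.exp (a n x y t))
        (fun n x y t => Real.exp (b n x y t)) n x y t =
      Real.exp (a n x y t + b n x y t) *
        (partialX (partialX a) n x y t + partialX (partialX b) n x y t +
          (partialX a n x y t - partialX b n x y t) ^ 2) := by
  simp only [hirota4, iteratedDeriv_zero, add_zero, sub_zero, ← Real.exp_add]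
  rw [iteratedDeriv_two_exp_comp
    (HasDerivAt.reflected_add (ha.hasDerivAt_x n · y t) (hb.hasDerivAt_x n · y t) x)
    (HasDerivAt.reflected_sub (ha.partialX.hasDerivAt_x n · y t)
      (hb.partialX.hasDerivAt_x n · y t) x)]
  simp

theorem hirota4_yy_exp (ha : Smooth4 a) (hb : Smooth4 b) (n x y t : ℝ) :
    hirota4 0 2 0 0 (fun n x y t => Real.exp (a n x y t))
        (fun n x y t => Real.exp (b n x y t)) n x y t =
      Real.exp (a n x y t + b n x y t) *
        (partialY (partialY a) n x y t + partialY (partialY b) n x y t +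
          (partialY a n x y t - partialY b n x y t) ^ 2) := by
  simp only [hirota4, iteratedDeriv_zero, add_zero, sub_zero, ← Real.exp_add]
  rw [iteratedDeriv_two_exp_comp
    (HasDerivAt.reflected_add (ha.hasDerivAt_y n x · t) (hb.hasDerivAt_y n x · t) y)
    (HasDerivAt.reflected_sub (ha.partialY.hasDerivAt_y n x · t)
      (hb.partialY.hasDerivAt_y n x · t) y)]
  simp

theorem hirota4_xxx_exp (ha : Smooth4 a) (hb : Smooth4 b) (n x y t : ℝ) :
    hirota4 3 0 0 0 (fun n x y t => Real.exp (a n x y t))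
        (fun n x y t => Real.exp (b n x y t)) n x y t =
      Real.exp (a n x y t + b n x y t) *
        (partialX (partialX (partialX a)) n x y t - partialX (partialX (partialX b)) n x y t +
          3 * (partialX a n x y t - partialX b n x y t) *
            (partialX (partialX a) n x y t + partialX (partialX b) n x y t) +
          (partialX a n x y t - partialX b n x y t) ^ 3) := by
  simp only [hirota4, iteratedDeriv_zero, add_zero, sub_zero, ← Real.exp_add]
  rw [iteratedDeriv_three_exp_comp
    (HasDerivAt.reflected_add (ha.hasDerivAt_x n · y t) (hb.hasDerivAt_x n · y t) x)
    (HasDerivAt.reflected_sub (ha.partialX.hasDerivAt_x n · y t)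
      (hb.partialX.hasDerivAt_x n · y t) x)
    (HasDerivAt.reflected_add (ha.partialX.partialX.hasDerivAt_x n · y t)
      (hb.partialX.partialX.hasDerivAt_x n · y t) x)]
  simp

theorem hirota4_xxxx_exp_self (ha : Smooth4 a) (n x y t : ℝ) :
    hirota4 4 0 0 0 (fun n x y t => Real.exp (a n x y t))
        (fun n x y t => Real.exp (a n x y t)) n x y t =
      Real.exp (a n x y t + a n x y t) *
        (2 * partialX (partialX (partialX (partialX a))) n x y t +
          12 * partialX (partialX a) n x y t ^ 2) := by
  simp only [hirota4, iteratedDeriv_zero, add_zero, sub_zero, ← Real.exp_add]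
  rw [iteratedDeriv_four_exp_comp
    (HasDerivAt.reflected_add (ha.hasDerivAt_x n · y t) (ha.hasDerivAt_x n · y t) x)
    (HasDerivAt.reflected_sub (ha.partialX.hasDerivAt_x n · y t)
      (ha.partialX.hasDerivAt_x n · y t) x)
    (HasDerivAt.reflected_add (ha.partialX.partialX.hasDerivAt_x n · y t)
      (ha.partialX.partialX.hasDerivAt_x n · y t) x)
    (HasDerivAt.reflected_sub (ha.partialX.partialX.partialX.hasDerivAt_x n · y t)
      (ha.partialX.partialX.partialX.hasDerivAt_x n · y t) x)]
  simp
  ring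

theorem hirota4_xy_exp (ha : Smooth4 a) (hb : Smooth4 b) (n x y t : ℝ) :
    hirota4 1 1 0 0 (fun n x y t => Real.exp (a n x y t))
        (fun n x y t => Real.exp (b n x y t)) n x y t =
      Real.exp (a n x y t + b n x y t) *
        (partialX (partialY a) n x y t + partialX (partialY b) n x y t +
          (partialX a n x y t - partialX b n x y t) *
            (partialY a n x y t - partialY b n x y t)) := by
  have hin (r : ℝ) := congrFun (iteratedDeriv_one_exp_comp (HasDerivAt.reflected_add
    (ha.hasDerivAt_y n (x + r) · t) (hb.hasDerivAt_y n (x - r) · t) y)) 0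
  simp only [hirota4, iteratedDeriv_zero, add_zero, sub_zero, ← Real.exp_add]
  simp only [hin, iteratedDeriv_one, add_zero, sub_zero]
  have h₁ := (HasDerivAt.reflected_add (ha.hasDerivAt_x n · y t) (hb.hasDerivAt_x n · y t) x 0).exp
  have h₂ := HasDerivAt.reflected_sub (ha.partialY.hasDerivAt_x n · y t)
    (hb.partialY.hasDerivAt_x n · y t) x 0
  refine ((h₁.mul h₂).congr_deriv ?_).deriv
  simp only [add_zero, sub_zero]
  ring

theorem hirota4_xt_exp (ha : Smooth4 a) (hb : Smooth4 b) (n x y t : ℝ) :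
    hirota4 1 0 1 0 (fun n x y t => Real.exp (a n x y t))
        (fun n x y t => Real.exp (b n x y t)) n x y t =
      Real.exp (a n x y t + b n x y t) *
        (partialX (partialT a) n x y t + partialX (partialT b) n x y t +
          (partialX a n x y t - partialX b n x y t) *
            (partialT a n x y t - partialT b n x y t)) := by
  have hin (r : ℝ) := congrFun (iteratedDeriv_one_exp_comp (HasDerivAt.reflected_add
    (ha.hasDerivAt_t n (x + r) y) (hb.hasDerivAt_t n (x - r) y) t)) 0
  simp only [hirota4, iteratedDeriv_zero, add_zero, sub_zero, ← Real.exp_add]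
  simp only [hin, iteratedDeriv_one, add_zero, sub_zero]
  have h₁ := (HasDerivAt.reflected_add (ha.hasDerivAt_x n · y t) (hb.hasDerivAt_x n · y t) x 0).exp
  have h₂ := HasDerivAt.reflected_sub (ha.partialT.hasDerivAt_x n · y t)
    (hb.partialT.hasDerivAt_x n · y t) x 0
  refine ((h₁.mul h₂).congr_deriv ?_).deriv
  simp only [add_zero, sub_zero]
  ring

end Hirota

theorem HasDerivAt.eq_zero_of_forall_eq_zero {F : ℝ → ℝ} {F' x : ℝ} (hF : HasDerivAt F F' x)
    (h₀ : ∀ r, F r = 0) : F' = 0 := by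
  rw [funext h₀] at hF
  exact hF.unique (hasDerivAt_const x 0)

/-- Theorem 2 (nonlinear form of the semi-discrete KP system). -/
theorem semidiscrete_KP_nonlinear_form
    (h : ℝ) (hh : 0 < h) (f : ℝ → ℝ → ℝ → ℝ → ℝ)
    (hf : ContDiff ℝ (⊤ : ℕ∞) (fun pt : ℝ × ℝ × ℝ × ℝ => f pt.1 pt.2.1 pt.2.2.1 pt.2.2.2))
    (hfpos : ∀ n x y t, 0 < f n x y t)
    (heq1 : ∀ n x y t,
      hirota4 4 0 0 0 f f n x y t - 4 * hirota4 1 0 1 0 f f n x y t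
        + 3 * hirota4 0 2 0 0 f f n x y t = 0)
    (heq2 : ∀ n x y t,
      hirota4 0 1 0 0 f (fun n' x' y' t' => f (n' - h) x' y' t') n x y t
        - hirota4 2 0 0 0 f (fun n' x' y' t' => f (n' - h) x' y' t') n x y t
        + (2/h) * hirota4 1 0 0 0 f (fun n' x' y' t' => f (n' - h) x' y' t') n x y t = 0)
    (heq3 : ∀ n x y t,
      3 * hirota4 1 1 0 0 f (fun n' x' y' t' => f (n' - h) x' y' t') n x y t
        - 4 * hirota4 0 0 1 0 f (fun n' x' y' t' => f (n' - h) x' y' t') n x y t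
        + hirota4 3 0 0 0 f (fun n' x' y' t' => f (n' - h) x' y' t') n x y t
        - (6/h) * hirota4 0 1 0 0 f (fun n' x' y' t' => f (n' - h) x' y' t') n x y t = 0)
    (w v u p q r : ℝ → ℝ → ℝ → ℝ → ℝ)
    (hw : ∀ n x y t, w n x y t = Real.log (f n x y t))
    (hv : ∀ n x y t, v n x y t = deriv (fun x' => w n x' y t) x)
    (hu : ∀ n x y t, u n x y t = deriv (fun x' => v n x' y t) x)
    (hp : ∀ n x y t, p n x y t = deriv (fun x' => u n x' y t) x)
    (hq : ∀ n x y t, q n x y t = deriv (fun x' => p n x' y t) x)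
    (hr : ∀ n x y t, r n x y t = deriv (fun x' => q n x' y t) x) :
    ∀ n x y t,
      (4 * deriv (fun t' => u n x y t') t - r n x y t
        - 12 * u n x y t * p n x y t
        - 3 * deriv (fun y' => deriv (fun y'' => v n x y'' t) y') y = 0) ∧
      (p (n + h) x y t + p n x y t =
        (2/h) * (u (n + h) x y t - u n x y t)
          + (deriv (fun y' => v (n + h) x y' t) y - deriv (fun y' => v n x y' t) y)
          - 2 * (v (n + h) x y t - v n x y t) * (u (n + h) x y t - u n x y t)) ∧
      (q (n + h) x y t + q n x y t =
        (2/h) * (p (n + h) x y t - p n x y t)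
          + (deriv (fun y' => u (n + h) x y' t) y - deriv (fun y' => u n x y' t) y)
          - 2 * (v (n + h) x y t - v n x y t) * (p (n + h) x y t - p n x y t)
          - 2 * (u (n + h) x y t - u n x y t)^2) ∧
      (r (n + h) x y t + r n x y t =
        (2/h) * (q (n + h) x y t - q n x y t)
          + (deriv (fun y' => p (n + h) x y' t) y - deriv (fun y' => p n x y' t) y)
          - 2 * (v (n + h) x y t - v n x y t) * (q (n + h) x y t - q n x y t)
          - 6 * (u (n + h) x y t - u n x y t) * (p (n + h) x y t - p n x y t)) ∧
      (3 * (deriv (fun y' => u (n + h) x y' t) y + deriv (fun y' => u n x y' t) y)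
          + 6 * (u (n + h) x y t + u n x y t) * (u (n + h) x y t - u n x y t)
          + 6 * (u (n + h) x y t - u n x y t) * (v (n + h) x y t - v n x y t)^2
          + 3 * (deriv (fun y' => v (n + h) x y' t) y - deriv (fun y' => v n x y' t) y)
              * (v (n + h) x y t - v n x y t)
          - 4 * (deriv (fun t' => v (n + h) x y t') t - deriv (fun t' => v n x y t') t)
          + (q (n + h) x y t - q n x y t)
          + 3 * (v (n + h) x y t - v n x y t) * (p (n + h) x y t + p n x y t)
          - (6/h) * (u (n + h) x y t - u n x y t) * (v (n + h) x y t - v n x y t)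
        = (6/h) * (deriv (fun y' => v (n + h) x y' t) y
            - deriv (fun y' => v n x y' t) y)) := by
  have hwS : Smooth4 w := by
    rw [show w = fun n x y t => Real.log (f n x y t) by funext n x y t; exact hw n x y t]
    exact hf.log fun z => (hfpos _ _ _ _).ne'
  obtain rfl : f = fun n x y t => Real.exp (w n x y t) := by
    funext n x y t
    rw [hw, Real.exp_log (hfpos n x y t)]
  have hwS' : Smooth4 (fun n x y t => w (n - h) x y t) :=
    hwS.comp (g := fun z : ℝ × ℝ × ℝ × ℝ => w z.1 z.2.1 z.2.2.1 z.2.2.2)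
      (f := fun z : ℝ × ℝ × ℝ × ℝ => (z.1 - h, z.2)) (by fun_prop)
  obtain rfl : v = partialX w := by funext n x y t; exact hv n x y t
  obtain rfl : u = partialX (partialX w) := by funext n x y t; exact hu n x y t
  obtain rfl : p = partialX (partialX (partialX w)) := by funext n x y t; exact hp n x y t
  obtain rfl : q = partialX (partialX (partialX (partialX w))) := by
    funext n x y t; exact hq n x y t
  obtain rfl : r = partialX (partialX (partialX (partialX (partialX w)))) := by
    funext n x y t; exact hr n x y t
  clear hw hv hu hp hq hr hf hfpos
  intro n x y t
  have kp (x : ℝ) : partialX (partialX (partialX (partialX w))) n x y t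
      + 6 * partialX (partialX w) n x y t ^ 2 - 4 * partialT (partialX w) n x y t
      + 3 * partialY (partialY w) n x y t = 0 := by
    have e := heq1 n x y t
    rw [hirota4_xxxx_exp_self hwS, hirota4_xt_exp hwS hwS, hirota4_yy_exp hwS hwS,
      hwS.partialX_partialT] at e
    refine (mul_eq_zero.mp ?_).resolve_left (Real.exp_pos (w n x y t + w n x y t)).ne'
    linear_combination e / 2
  have bt (x : ℝ) : (partialY w (n + h) x y t - partialY w n x y t)
      - (partialX (partialX w) (n + h) x y t + partialX (partialX w) n x y t
        + (partialX w (n + h) x y t - partialX w n x y t) ^ 2)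
      + (2 / h) * (partialX w (n + h) x y t - partialX w n x y t) = 0 := by
    have e := heq2 (n + h) x y t
    rw [hirota4_y_exp hwS hwS', hirota4_xx_exp hwS hwS', hirota4_x_exp hwS hwS'] at e
    simp only [partialX, partialY, add_sub_cancel_right] at e
    refine (mul_eq_zero.mp ?_).resolve_left (Real.exp_pos (w (n + h) x y t + w n x y t)).ne'
    simp only [partialX, partialY]
    linear_combination e
  have bt' (x : ℝ) : 3 * (partialY (partialX w) (n + h) x y t + partialY (partialX w) n x y t
        + (partialX w (n + h) x y t - partialX w n x y t)
          * (partialY w (n + h) x y t - partialY w n x y t))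
      - 4 * (partialT w (n + h) x y t - partialT w n x y t)
      + (partialX (partialX (partialX w)) (n + h) x y t - partialX (partialX (partialX w)) n x y t
        + 3 * (partialX w (n + h) x y t - partialX w n x y t)
          * (partialX (partialX w) (n + h) x y t + partialX (partialX w) n x y t)
        + (partialX w (n + h) x y t - partialX w n x y t) ^ 3)
      - (6 / h) * (partialY w (n + h) x y t - partialY w n x y t) = 0 := by
    have e := heq3 (n + h) x y t
    rw [hirota4_xy_exp hwS hwS', hirota4_t_exp hwS hwS', hirota4_xxx_exp hwS hwS',
      hirota4_y_exp hwS hwS'] at e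
    rw [← hwS.partialX_partialY]
    simp only [partialX, partialY, partialT, add_sub_cancel_right] at e
    refine (mul_eq_zero.mp ?_).resolve_left (Real.exp_pos (w (n + h) x y t + w n x y t)).ne'
    simp only [partialX, partialY, partialT]
    linear_combination e
  have hv := hwS.partialX
  have hu := hv.partialX
  have hp := hu.partialX
  have hq := hp.partialX
  have dv (m x : ℝ) := hv.hasDerivAt_x m x y t
  have du (m x : ℝ) := hu.hasDerivAt_x m x y t
  have dp (m x : ℝ) := hp.hasDerivAt_x m x y t
  have dq (m x : ℝ) := hq.hasDerivAt_x m x y t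
  have dwt (m x : ℝ) := hwS.partialT.hasDerivAt_x m x y t
  have dwy (m x : ℝ) := hwS.partialY.hasDerivAt_x m x y t
  have dwyy (m x : ℝ) := hwS.partialY.partialY.hasDerivAt_x m x y t
  have dvt (m x : ℝ) := hv.partialT.hasDerivAt_x m x y t
  have dvy (m x : ℝ) := hv.partialY.hasDerivAt_x m x y t
  have duy (m x : ℝ) := hu.partialY.hasDerivAt_x m x y t
  simp only [hwS.partialX_partialT, hwS.partialX_partialY, hv.partialX_partialT,
    hv.partialX_partialY, hu.partialX_partialY, hwS.partialY.partialX_partialY]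
    at dwt dwy dwyy dvt dvy duy
  have eqP (x : ℝ) := HasDerivAt.eq_zero_of_forall_eq_zero
    ((((dwy (n + h) x).fun_sub (dwy n x)).fun_sub (((du (n + h) x).fun_add (du n x)).fun_add
      (((dv (n + h) x).fun_sub (dv n x)).fun_pow 2))).fun_add
        (((dv (n + h) x).fun_sub (dv n x)).const_mul (2 / h))) bt
  simp only [Nat.cast_ofNat, Nat.reduceSub, pow_one] at eqP
  have eqQ (x : ℝ) := HasDerivAt.eq_zero_of_forall_eq_zero
    ((((dvy (n + h) x).fun_sub (dvy n x)).fun_sub (((dp (n + h) x).fun_add (dp n x)).fun_add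
      ((((dv (n + h) x).fun_sub (dv n x)).const_mul 2).fun_mul
        ((du (n + h) x).fun_sub (du n x))))).fun_add
          (((du (n + h) x).fun_sub (du n x)).const_mul (2 / h))) eqP
  have eqR := HasDerivAt.eq_zero_of_forall_eq_zero
    ((((duy (n + h) x).fun_sub (duy n x)).fun_sub (((dq (n + h) x).fun_add (dq n x)).fun_add
      (((((du (n + h) x).fun_sub (du n x)).const_mul 2).fun_mul
          ((du (n + h) x).fun_sub (du n x))).fun_add
        ((((dv (n + h) x).fun_sub (dv n x)).const_mul 2).fun_mul
          ((dp (n + h) x).fun_sub (dp n x)))))).fun_add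
            (((dp (n + h) x).fun_sub (dp n x)).const_mul (2 / h))) eqQ
  have eqKP := HasDerivAt.eq_zero_of_forall_eq_zero
    ((((dq n x).fun_add (((du n x).fun_pow 2).const_mul 6)).fun_sub
      ((dvt n x).const_mul 4)).fun_add ((dwyy n x).const_mul 3)) kp
  have eqV := HasDerivAt.eq_zero_of_forall_eq_zero
    (((((((dvy (n + h) x).fun_add (dvy n x)).fun_add
        (((dv (n + h) x).fun_sub (dv n x)).fun_mul
          ((dwy (n + h) x).fun_sub (dwy n x)))).const_mul 3).fun_sub
      (((dwt (n + h) x).fun_sub (dwt n x)).const_mul 4)).fun_add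
        ((((dp (n + h) x).fun_sub (dp n x)).fun_add
          ((((dv (n + h) x).fun_sub (dv n x)).const_mul 3).fun_mul
            ((du (n + h) x).fun_add (du n x)))).fun_add
          (((dv (n + h) x).fun_sub (dv n x)).fun_pow 3))).fun_sub
      (((dwy (n + h) x).fun_sub (dwy n x)).const_mul (6 / h))) bt'
  simp only [Nat.cast_ofNat, Nat.reduceSub, pow_one] at eqKP eqV
  have e := bt x
  have eP := eqP x
  have eQ := eqQ x
  simp only [partialY, partialT] at e eP eQ eqR eqKP eqV
  refine ⟨?_, ?_, ?_, ?_, ?_⟩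
  · linear_combination -eqKP
  · linear_combination -eP
  · linear_combination -eQ
  · linear_combination -eqR
  · linear_combination eqV
      - 3 * (partialX (partialX w) (n + h) x y t - partialX (partialX w) n x y t) * e
end

section
/- (Bäcklund transformation for the semi-discrete Sawada–Kotera system.) Let h > 0, λ ∈ ℝ, and let f, g : ℝ³ → ℝ be smooth functions of (n, x, t) with f nowhere zero. Suppose f satisfies D_x(D_t + D_x⁵) f·f = 0, (D_x³ − (6/h)D_x² + (12/h²)D_x) f_n·f_{n−h} = 0 and (2D_t − 3D_x⁵ + (30/h)D_x⁴ − (60/h²)D_x³) f_n·f_{n−h} = 0 at every point, and suppose g satisfies at every point: (i) D_x³ f·g = λ f g; (ii) (2D_t − 3D_x⁵ − 15λ D_x²) f·g = 0; (iii) (D_x e^{(h/2)D_n} − D_x e^{−(h/2)D_n}) f·g = (2/h)(e^{(h/2)D_n} + e^{−(h/2)D_n}) f·g; (iv) (D_x³ e^{(h/2)D_n} − D_x³ e^{−(h/2)D_n} − (6/h)D_x² e^{(h/2)D_n} − (6/h)D_x² e^{−(h/2)D_n} + 2λ e^{(h/2)D_n} − 2λ e^{−(h/2)D_n}) f·g =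 0. Then g satisfies D_x(D_t + D_x⁵) g·g = 0, (D_x³ − (6/h)D_x² + (12/h²)D_x) g_n·g_{n−h} = 0 and (2D_t − 3D_x⁵ + (30/h)D_x⁴ − (60/h²)D_x³) g_n·g_{n−h} = 0 at every point. -/
/-- Hirota bilinear operator `D_x^a D_t^c e^{δ D_n}` applied to a pair of functions
of `(n, x, t)`, evaluated at `(n, x, t)`. -/
noncomputable def hirota3 (a c : ℕ) (δ : ℝ) (A B : ℝ → ℝ → ℝ → ℝ) (n x t : ℝ) : ℝ :=
  iteratedDeriv a (fun r =>
    iteratedDeriv c (fun w => A (n + δ) (x + r) (t + w) * B (n - δ) (x - r) (t - w)) 0) 0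

open Finset

/-- A sequence of functions on the line, each of which is the derivative of the preceding one. -/
structure IsJet (u : ℕ → ℝ → ℝ) : Prop where
  differentiable : ∀ i, Differentiable ℝ (u i)
  deriv_eq : ∀ i, deriv (u i) = u (i + 1)

theorem isJet_iteratedDeriv {u : ℝ → ℝ} (hu : ContDiff ℝ (⊤ : ℕ∞) u) :
    IsJet (fun i => iteratedDeriv i u) where
  differentiable i := hu.differentiable_iteratedDeriv i (by exact_mod_cast ENat.natCast_lt_top i)
  deriv_eq _ := iteratedDeriv_succ.symm

/-- The Hirota operator `D_x^a` applied to the pair of functions with jets `u` and `v`. -/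
def jetHirota (a : ℕ) (u v : ℕ → ℝ → ℝ) (x : ℝ) : ℝ :=
  ∑ i ∈ range (a + 1), a.choose i * u i x * ((-1) ^ (a - i) * v (a - i) x)

theorem iteratedDeriv_mul_reflect (a : ℕ) {u v : ℝ → ℝ} (hu : ContDiff ℝ (⊤ : ℕ∞) u)
    (hv : ContDiff ℝ (⊤ : ℕ∞) v) (x : ℝ) :
    iteratedDeriv a (fun r => u (x + r) * v (x - r)) 0 =
      jetHirota a (fun i => iteratedDeriv i u) (fun i => iteratedDeriv i v) x := by
  have hu' : ContDiff ℝ a (fun r => u (x + r)) :=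
    (hu.of_le (by exact_mod_cast le_top)).comp (contDiff_const.add contDiff_id)
  have hv' : ContDiff ℝ a (fun r => v (x - r)) :=
    (hv.of_le (by exact_mod_cast le_top)).comp (contDiff_const.sub contDiff_id)
  have := iteratedDeriv_mul (x := (0 : ℝ)) hu'.contDiffAt hv'.contDiffAt
  simpa only [Pi.mul_def, iteratedDeriv_comp_const_add, iteratedDeriv_comp_const_sub, add_zero,
    sub_zero, smul_eq_mul, jetHirota] using this

/-- Joint smoothness of a function of `(n, x, t)`. -/
def Smooth3 (A : ℝ → ℝ → ℝ → ℝ) : Prop :=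
  ContDiff ℝ (⊤ : ℕ∞) (fun pt : ℝ × ℝ × ℝ => A pt.1 pt.2.1 pt.2.2)

/-- The partial derivative in the last variable. -/
noncomputable def timeDeriv (A : ℝ → ℝ → ℝ → ℝ) (n x t : ℝ) : ℝ :=
  deriv (A n x) t

/-- The sequence of partial derivatives in `x`, as functions of `x`. -/
noncomputable def spaceJet (A : ℝ → ℝ → ℝ → ℝ) (n t : ℝ) (i : ℕ) : ℝ → ℝ :=
  iteratedDeriv i (fun x => A n x t)

namespace Smooth3

variable {A B : ℝ → ℝ → ℝ → ℝ}

theorem comp {E : Type*} [NormedAddCommGroup E] [NormedSpace ℝ E] (hA : Smooth3 A)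
    {p q r : E → ℝ} (hp : ContDiff ℝ (⊤ : ℕ∞) p) (hq : ContDiff ℝ (⊤ : ℕ∞) q)
    (hr : ContDiff ℝ (⊤ : ℕ∞) r) : ContDiff ℝ (⊤ : ℕ∞) (fun e => A (p e) (q e) (r e)) :=
  ContDiff.comp (g := fun pt : ℝ × ℝ × ℝ => A pt.1 pt.2.1 pt.2.2) hA (hp.prodMk (hq.prodMk hr))

theorem space (hA : Smooth3 A) (n t : ℝ) : ContDiff ℝ (⊤ : ℕ∞) (fun x => A n x t) :=
  hA.comp contDiff_const contDiff_id contDiff_const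

theorem time (hA : Smooth3 A) (n x : ℝ) : ContDiff ℝ (⊤ : ℕ∞) (A n x) :=
  hA.comp contDiff_const contDiff_const contDiff_id

theorem isJet (hA : Smooth3 A) (n t : ℝ) : IsJet (spaceJet A n t) :=
  isJet_iteratedDeriv (hA.space n t)

theorem shift (hA : Smooth3 A) (h : ℝ) : Smooth3 (fun n x t => A (n - h) x t) :=
  hA.comp (contDiff_fst.sub contDiff_const) (contDiff_fst.comp contDiff_snd)
    (contDiff_snd.comp contDiff_snd)

theorem timeDeriv (hA : Smooth3 A) : Smooth3 (timeDeriv A) := by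
  have key : _root_.timeDeriv A =
      fun n x t => fderiv ℝ (fun pt : ℝ × ℝ × ℝ => A pt.1 pt.2.1 pt.2.2) (n, x, t) (0, 0, 1) := by
    funext n x t
    have hd : HasDerivAt (fun s : ℝ => ((n, x, s) : ℝ × ℝ × ℝ)) (0, 0, 1) t :=
      (hasDerivAt_const t n).prodMk ((hasDerivAt_const t x).prodMk (hasDerivAt_id t))
    have hf : DifferentiableAt ℝ (fun pt : ℝ × ℝ × ℝ => A pt.1 pt.2.1 pt.2.2) (n, x, t) :=
      ContDiff.differentiable hA (by simp) _
    exact (hf.hasFDerivAt.comp_hasDerivAt t hd).deriv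
  rw [key]
  exact (ContDiff.fderiv_right hA le_rfl).clm_apply contDiff_const

end Smooth3

section hirota3

variable {A B : ℝ → ℝ → ℝ → ℝ}

theorem hirota3_space (hA : Smooth3 A) (hB : Smooth3 B) (a : ℕ) (δ n x t : ℝ) :
    hirota3 a 0 δ A B n x t =
      jetHirota a (spaceJet A (n + δ) t) (spaceJet B (n - δ) t) x := by
  simp only [hirota3, iteratedDeriv_zero, add_zero, sub_zero]
  exact iteratedDeriv_mul_reflect a (hA.space _ t) (hB.space _ t) x

theorem hirota3_time (hA : Smooth3 A) (hB : Smooth3 B) (a : ℕ) (δ n x t : ℝ) :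
    hirota3 a 1 δ A B n x t =
      jetHirota a (spaceJet (timeDeriv A) (n + δ) t) (spaceJet B (n - δ) t) x -
        jetHirota a (spaceJet A (n + δ) t) (spaceJet (timeDeriv B) (n - δ) t) x := by
  have hmul {C D : ℝ → ℝ → ℝ → ℝ} (hC : Smooth3 C) (hD : Smooth3 D) :
      ContDiffAt ℝ a (fun r => C (n + δ) (x + r) t * D (n - δ) (x - r) t) 0 :=
    ((hC.comp contDiff_const (contDiff_const.add contDiff_id) contDiff_const).mul
      (hD.comp contDiff_const (contDiff_const.sub contDiff_id) contDiff_const)).contDiffAt.of_le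
        (by exact_mod_cast le_top)
  rw [← hirota3_space hA.timeDeriv hB, ← hirota3_space hA hB.timeDeriv]
  simp only [hirota3, iteratedDeriv_zero, add_zero, sub_zero]
  rw [← iteratedDeriv_fun_sub (hmul hA.timeDeriv hB) (hmul hA hB.timeDeriv)]
  congr 1
  funext r
  have := iteratedDeriv_mul_reflect 1 (hA.time (n + δ) (x + r)) (hB.time (n - δ) (x - r)) t
  simp only [jetHirota, sum_range_succ, range_zero, sum_empty, iteratedDeriv_zero,
    iteratedDeriv_one] at this
  rw [iteratedDeriv_one, this]
  simp only [timeDeriv]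
  norm_num
  ring

end hirota3

theorem deriv_eq_zero_of_forall {φ : ℝ → ℝ} (hφ : ∀ x, φ x = 0) (x : ℝ) : deriv φ x = 0 := by
  rw [funext hφ, deriv_const]

/-- The bilinear Sawada–Kotera equation is preserved by its continuous Bäcklund transformation;
`ut` and `vt` are the jets of the time derivatives. -/
theorem sawadaKotera_of_backlund {u v ut vt : ℕ → ℝ → ℝ} {lam : ℝ} (hu : IsJet u) (hv : IsJet v)
    (hut : IsJet ut) (hvt : IsJet vt) (hu0 : ∀ x, u 0 x ≠ 0)
    (heq : ∀ x, jetHirota 1 ut u x - jetHirota 1 u ut x + jetHirota 6 u u x = 0)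
    (h1 : ∀ x, jetHirota 3 u v x - lam * (u 0 x * v 0 x) = 0)
    (h2 : ∀ x, 2 * (jetHirota 0 ut v x - jetHirota 0 u vt x) - 3 * jetHirota 5 u v x
      - 15 * lam * jetHirota 2 u v x = 0) (x : ℝ) :
    jetHirota 1 vt v x - jetHirota 1 v vt x + jetHirota 6 v v x = 0 := by
  obtain ⟨du, eu⟩ := hu
  obtain ⟨dv, ev⟩ := hv
  obtain ⟨dut, eut⟩ := hut
  obtain ⟨dvt, evt⟩ := hvt
  simp [jetHirota, sum_range_succ, Nat.choose] at heq h1 h2 ⊢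
  have h1_x := deriv_eq_zero_of_forall h1
  simp (disch := fun_prop) only [deriv_fun_add, deriv_fun_sub, deriv_fun_mul, deriv.fun_neg,
    deriv_const, eu, ev] at h1_x
  have h1_xx := deriv_eq_zero_of_forall h1_x
  simp (disch := fun_prop) only [deriv_fun_add, deriv_fun_sub, deriv_fun_mul, deriv.fun_neg,
    deriv_const, eu, ev] at h1_xx
  have h1_xxx := deriv_eq_zero_of_forall h1_xx
  simp (disch := fun_prop) only [deriv_fun_add, deriv_fun_sub, deriv_fun_mul, deriv.fun_neg,
    deriv_const, eu, ev] at h1_xxx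
  have h2_x := deriv_eq_zero_of_forall h2
  simp (disch := fun_prop) only [deriv_fun_add, deriv_fun_sub, deriv_fun_mul, deriv.fun_neg,
    deriv_const, eu, ev, eut, evt] at h2_x
  refine (mul_eq_zero.mp ?_).resolve_left (pow_ne_zero 2 (hu0 x))
  linear_combination (v 0 x) ^ 2 * heq x - u 0 x * v 0 x * h2_x x
    + (u 1 x * v 0 x + u 0 x * v 1 x) * h2 x
    + 20 * (u 0 x * v 3 x + u 3 x * v 0 x) * h1 x
    - 30 * (u 0 x * v 2 x + u 2 x * v 0 x) * h1_x x
    + 15 * (u 0 x * v 1 x + u 1 x * v 0 x) * h1_xx x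
    - 5 * (u 0 x * v 0 x) * h1_xxx x

section semidiscrete

variable {u v p q : ℕ → ℝ → ℝ} {k lam : ℝ}

/-- The first lattice equation is preserved; `u, p` and `v, q` are the jets of the two solutions
at neighbouring lattice sites. -/
theorem lattice_eq_of_backlund (hu : IsJet u) (hv : IsJet v) (hp : IsJet p) (hq : IsJet q)
    (hu0 : ∀ x, u 0 x ≠ 0) (hp0 : ∀ x, p 0 x ≠ 0)
    (heq : ∀ x, jetHirota 3 u p x - 3 * k * jetHirota 2 u p x
      + 3 * k ^ 2 * jetHirota 1 u p x = 0)
    (huv : ∀ x, jetHirota 3 u v x - lam * (u 0 x * v 0 x) = 0)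
    (hpq : ∀ x, jetHirota 3 p q x - lam * (p 0 x * q 0 x) = 0)
    (h3 : ∀ x, jetHirota 1 u q x - jetHirota 1 p v x
      - k * (jetHirota 0 u q x + jetHirota 0 p v x) = 0) (x : ℝ) :
    jetHirota 3 v q x - 3 * k * jetHirota 2 v q x + 3 * k ^ 2 * jetHirota 1 v q x = 0 := by
  obtain ⟨du, eu⟩ := hu
  obtain ⟨dv, ev⟩ := hv
  obtain ⟨dp, ep⟩ := hp
  obtain ⟨dq, eq⟩ := hq
  simp [jetHirota, sum_range_succ, Nat.choose] at heq huv hpq h3 ⊢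
  have h3_x := deriv_eq_zero_of_forall h3
  simp (disch := fun_prop) only [deriv_fun_add, deriv_fun_sub, deriv_fun_mul, deriv.fun_neg,
    deriv_const, eu, ev, ep, eq] at h3_x
  refine (mul_eq_zero.mp ?_).resolve_left (mul_ne_zero (hu0 x) (hp0 x))
  linear_combination v 0 x * q 0 x * heq x
    + 3 * (u 0 x * q 1 x * k + u 1 x * q 0 x * k + u 0 x * q 2 x - u 2 x * q 0 x) * h3 x
    - 3 * (u 0 x * q 0 x * k + u 0 x * q 1 x - u 1 x * q 0 x) * h3_x x
    - p 0 x * q 0 x * huv x + u 0 x * v 0 x * hpq x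

/-- The lattice evolution equation is preserved; `ut, vt, pt, qt` are the jets of the time
derivatives. -/
theorem lattice_evolution_of_backlund {ut vt pt qt : ℕ → ℝ → ℝ}
    (hu : IsJet u) (hv : IsJet v) (hp : IsJet p) (hq : IsJet q)
    (hu0 : ∀ x, u 0 x ≠ 0) (hp0 : ∀ x, p 0 x ≠ 0)
    (heq : ∀ x, 2 * (jetHirota 0 ut p x - jetHirota 0 u pt x) - 3 * jetHirota 5 u p x
      + 15 * k * jetHirota 4 u p x - 15 * k ^ 2 * jetHirota 3 u p x = 0)
    (huv : ∀ x, jetHirota 3 u v x - lam * (u 0 x * v 0 x) = 0)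
    (hpq : ∀ x, jetHirota 3 p q x - lam * (p 0 x * q 0 x) = 0)
    (huvt : ∀ x, 2 * (jetHirota 0 ut v x - jetHirota 0 u vt x) - 3 * jetHirota 5 u v x
      - 15 * lam * jetHirota 2 u v x = 0)
    (hpqt : ∀ x, 2 * (jetHirota 0 pt q x - jetHirota 0 p qt x) - 3 * jetHirota 5 p q x
      - 15 * lam * jetHirota 2 p q x = 0)
    (h3 : ∀ x, jetHirota 1 u q x - jetHirota 1 p v x
      - k * (jetHirota 0 u q x + jetHirota 0 p v x) = 0)
    (h4 : ∀ x, jetHirota 3 u q x - jetHirota 3 p v x - 3 * k * jetHirota 2 u q x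
      - 3 * k * jetHirota 2 p v x + 2 * lam * jetHirota 0 u q x
      - 2 * lam * jetHirota 0 p v x = 0) (x : ℝ) :
    2 * (jetHirota 0 vt q x - jetHirota 0 v qt x) - 3 * jetHirota 5 v q x
      + 15 * k * jetHirota 4 v q x - 15 * k ^ 2 * jetHirota 3 v q x = 0 := by
  obtain ⟨du, eu⟩ := hu
  obtain ⟨dv, ev⟩ := hv
  obtain ⟨dp, ep⟩ := hp
  obtain ⟨dq, eq⟩ := hq
  simp [jetHirota, sum_range_succ, Nat.choose] at heq huv hpq huvt hpqt h3 h4 ⊢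
  have h3_x := deriv_eq_zero_of_forall h3
  simp (disch := fun_prop) only [deriv_fun_add, deriv_fun_sub, deriv_fun_mul, deriv.fun_neg,
    deriv_const, eu, ev, ep, eq] at h3_x
  have h3_xx := deriv_eq_zero_of_forall h3_x
  simp (disch := fun_prop) only [deriv_fun_add, deriv_fun_sub, deriv_fun_mul, deriv.fun_neg,
    deriv_const, eu, ev, ep, eq] at h3_xx
  have h3_xxx := deriv_eq_zero_of_forall h3_xx
  simp (disch := fun_prop) only [deriv_fun_add, deriv_fun_sub, deriv_fun_mul, deriv.fun_neg,
    deriv_const, eu, ev, ep, eq] at h3_xxx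
  have h4_x := deriv_eq_zero_of_forall h4
  simp (disch := fun_prop) only [deriv_fun_add, deriv_fun_sub, deriv_fun_mul, deriv.fun_neg,
    deriv_const, eu, ev, ep, eq] at h4_x
  refine (mul_eq_zero.mp ?_).resolve_left (mul_ne_zero (hu0 x) (hp0 x))
  linear_combination v 0 x * q 0 x * heq x
    - p 0 x * q 0 x * huvt x + u 0 x * v 0 x * hpqt x
    - 15 / 2 * (u 0 x * q 1 x * k + u 1 x * q 0 x * k + u 0 x * q 2 x - u 2 x * q 0 x) * h4 x
    + 15 / 2 * (u 0 x * q 0 x * k + u 0 x * q 1 x - u 1 x * q 0 x) * h4_x x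
    + 15 * (u 0 x * q 1 x * lam + u 1 x * q 0 x * lam - 2 * u 0 x * q 3 x * k
      - 2 * u 3 x * q 0 x * k - u 0 x * q 4 x + u 4 x * q 0 x) * h3 x
    - 15 * (u 0 x * q 0 x * lam - 3 * u 0 x * q 2 x * k - 3 * u 2 x * q 0 x * k
      - 2 * u 0 x * q 3 x + 2 * u 3 x * q 0 x) * h3_x x
    - 45 / 2 * (u 0 x * q 1 x * k + u 1 x * q 0 x * k + u 0 x * q 2 x - u 2 x * q 0 x) * h3_xx x
    + 15 / 2 * (u 0 x * q 0 x * k + u 0 x * q 1 x - u 1 x * q 0 x) * h3_xxx x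
    - 15 * k ^ 2 * (p 0 x * q 0 x) * huv x + 15 * k ^ 2 * (u 0 x * v 0 x) * hpq x

end semidiscrete

/-- Proposition 4: Bäcklund transformation for the semi-discrete Sawada–Kotera system. -/
theorem semidiscrete_SK_Backlund
    (h : ℝ) (hh : 0 < h) (lam : ℝ) (f g : ℝ → ℝ → ℝ → ℝ)
    (hf : ContDiff ℝ (⊤ : ℕ∞) (fun pt : ℝ × ℝ × ℝ => f pt.1 pt.2.1 pt.2.2))
    (hg : ContDiff ℝ (⊤ : ℕ∞) (fun pt : ℝ × ℝ × ℝ => g pt.1 pt.2.1 pt.2.2))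
    (hfne : ∀ n x t, f n x t ≠ 0)
    (hfeq1 : ∀ n x t,
      hirota3 1 1 0 f f n x t + hirota3 6 0 0 f f n x t = 0)
    (hfeq2 : ∀ n x t,
      hirota3 3 0 0 f (fun n' x' t' => f (n' - h) x' t') n x t
        - (6/h) * hirota3 2 0 0 f (fun n' x' t' => f (n' - h) x' t') n x t
        + (12/h^2) * hirota3 1 0 0 f (fun n' x' t' => f (n' - h) x' t') n x t = 0)
    (hfeq3 : ∀ n x t,
      2 * hirota3 0 1 0 f (fun n' x' t' => f (n' - h) x' t') n x t
        - 3 * hirota3 5 0 0 f (fun n' x' t' => f (n' - h) x' t') n x t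
        + (30/h) * hirota3 4 0 0 f (fun n' x' t' => f (n' - h) x' t') n x t
        - (60/h^2) * hirota3 3 0 0 f (fun n' x' t' => f (n' - h) x' t') n x t = 0)
    (hbt1 : ∀ n x t,
      hirota3 3 0 0 f g n x t = lam * (f n x t * g n x t))
    (hbt2 : ∀ n x t,
      2 * hirota3 0 1 0 f g n x t - 3 * hirota3 5 0 0 f g n x t
        - 15 * lam * hirota3 2 0 0 f g n x t = 0)
    (hbt3 : ∀ n x t,
      hirota3 1 0 (h/2) f g n x t - hirota3 1 0 (-(h/2)) f g n x t =
        (2/h) * (hirota3 0 0 (h/2) f g n x t + hirota3 0 0 (-(h/2)) f g n x t))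
    (hbt4 : ∀ n x t,
      hirota3 3 0 (h/2) f g n x t - hirota3 3 0 (-(h/2)) f g n x t
        - (6/h) * hirota3 2 0 (h/2) f g n x t
        - (6/h) * hirota3 2 0 (-(h/2)) f g n x t
        + 2 * lam * hirota3 0 0 (h/2) f g n x t
        - 2 * lam * hirota3 0 0 (-(h/2)) f g n x t = 0) :
    (∀ n x t,
      hirota3 1 1 0 g g n x t + hirota3 6 0 0 g g n x t = 0) ∧
    (∀ n x t,
      hirota3 3 0 0 g (fun n' x' t' => g (n' - h) x' t') n x t
        - (6/h) * hirota3 2 0 0 g (fun n' x' t' => g (n' - h) x' t') n x t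
        + (12/h^2) * hirota3 1 0 0 g (fun n' x' t' => g (n' - h) x' t') n x t = 0) ∧
    (∀ n x t,
      2 * hirota3 0 1 0 g (fun n' x' t' => g (n' - h) x' t') n x t
        - 3 * hirota3 5 0 0 g (fun n' x' t' => g (n' - h) x' t') n x t
        + (30/h) * hirota3 4 0 0 g (fun n' x' t' => g (n' - h) x' t') n x t
        - (60/h^2) * hirota3 3 0 0 g (fun n' x' t' => g (n' - h) x' t') n x t = 0) := by
  have hf' : Smooth3 f := hf
  have hg' : Smooth3 g := hg
  have shift_jet (A : ℝ → ℝ → ℝ → ℝ) (n t : ℝ) :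
      spaceJet (fun n' x' t' => A (n' - h) x' t') n t = spaceJet A (n - h) t := rfl
  have shift_timeJet (A : ℝ → ℝ → ℝ → ℝ) (n t : ℝ) :
      spaceJet (timeDeriv fun n' x' t' => A (n' - h) x' t') n t =
        spaceJet (timeDeriv A) (n - h) t := rfl
  have jet_ne (n t x : ℝ) : spaceJet f n t 0 x ≠ 0 := by
    simpa [spaceJet] using hfne n x t
  simp only [hirota3_space hf' hf', hirota3_time hf' hf', add_zero, sub_zero] at hfeq1
  simp only [hirota3_space hf' (hf'.shift h), add_zero, sub_zero, shift_jet] at hfeq2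
  simp only [hirota3_space hf' (hf'.shift h), hirota3_time hf' (hf'.shift h), add_zero, sub_zero,
    shift_jet, shift_timeJet] at hfeq3
  simp only [hirota3_space hf' hg', hirota3_time hf' hg', add_zero, sub_zero] at hbt1 hbt2 hbt3 hbt4
  simp only [hirota3_space hg' hg', hirota3_time hg' hg', hirota3_space hg' (hg'.shift h),
    hirota3_time hg' (hg'.shift h), add_zero, sub_zero, shift_jet, shift_timeJet]
  have e1 (n t x : ℝ) : jetHirota 3 (spaceJet f n t) (spaceJet g n t) x
      - lam * (spaceJet f n t 0 x * spaceJet g n t 0 x) = 0 := by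
    simpa [spaceJet, sub_eq_zero] using hbt1 n x t
  have add_half (n : ℝ) : n - h / 2 + h / 2 = n := by ring
  have sub_half (n : ℝ) : n - h / 2 - h / 2 = n - h := by ring
  have e3 (n t x : ℝ) := hbt3 (n - h / 2) x t
  have e4 (n t x : ℝ) := hbt4 (n - h / 2) x t
  simp only [sub_neg_eq_add, ← sub_eq_add_neg, add_half, sub_half] at e3 e4
  refine ⟨fun n x t => ?_, fun n x t => ?_, fun n x t => ?_⟩
  · exact sawadaKotera_of_backlund (hf'.isJet n t) (hg'.isJet n t) (hf'.timeDeriv.isJet n t)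
      (hg'.timeDeriv.isJet n t) (jet_ne n t) (fun x => hfeq1 n x t) (e1 n t)
      (fun x => hbt2 n x t) x
  · have := lattice_eq_of_backlund (k := 2 / h) (hf'.isJet n t) (hg'.isJet n t)
      (hf'.isJet (n - h) t) (hg'.isJet (n - h) t) (jet_ne n t) (jet_ne (n - h) t)
      (fun x => by linear_combination hfeq2 n x t) (e1 n t) (e1 (n - h) t)
      (fun x => by linear_combination e3 n t x) x
    linear_combination this
  · have := lattice_evolution_of_backlund (k := 2 / h) (hf'.isJet n t) (hg'.isJet n t)
      (hf'.isJet (n - h) t) (hg'.isJet (n - h) t) (jet_ne n t) (jet_ne (n - h) t)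
      (fun x => by linear_combination hfeq3 n x t) (e1 n t) (e1 (n - h) t)
      (fun x => hbt2 n x t) (fun x => hbt2 (n - h) x t)
      (fun x => by linear_combination e3 n t x) (fun x => by linear_combination e4 n t x) x
    linear_combination this
end
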